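/- Let F : ℝ³ → ℝ be differentiable with F(0) = 0 and |f(u)| = o(|u|) as u → 0, where f := ∇F. If F satisfies conditions (*) and (**), then F satisfies condition (F9). -/

import Mathlib

open RealInnerProductSpace

noncomputable section

/-- Condition (F9) for a differentiable `F : ℝ³ → ℝ` with gradient `f = ∇F`:
`((t²−1)/2)⟨f(u),u⟩ + t⟨f(u),v⟩ + F(u) − F(tu+v) ≤ 0` for all `t ≥ 0`, `u, v ∈ ℝ³`,
with strict inequality whenever `u ≠ tu + v`. -/
def CondF9 (F : EuclideanSpace ℝ (Fin 3) → ℝ) : Prop :=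
  ∀ t : ℝ, 0 ≤ t → ∀ u v : EuclideanSpace ℝ (Fin 3),
    (t ^ 2 - 1) / 2 * ⟪gradient F u, u⟫ + t * ⟪gradient F u, v⟫ + F u - F (t • u + v) ≤ 0 ∧
    (u ≠ t • u + v →
      (t ^ 2 - 1) / 2 * ⟪gradient F u, u⟫ + t * ⟪gradient F u, v⟫ + F u - F (t • u + v) < 0)

/-- Condition (*): whenever `⟨f(u),v⟩ = ⟨f(v),u⟩ > 0` one has
`F(u) − F(v) ≤ (⟨f(u),u⟩² − ⟨f(u),v⟩²)/(2⟨f(u),u⟩)`, with strict inequality if in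
addition `F(u) ≠ F(v)`. -/
def CondStar (F : EuclideanSpace ℝ (Fin 3) → ℝ) : Prop :=
  ∀ u v : EuclideanSpace ℝ (Fin 3),
    ⟪gradient F u, v⟫ = ⟪gradient F v, u⟫ → 0 < ⟪gradient F u, v⟫ →
      (F u - F v ≤ (⟪gradient F u, u⟫ ^ 2 - ⟪gradient F u, v⟫ ^ 2)
          / (2 * ⟪gradient F u, u⟫) ∧
        (F u ≠ F v →
          F u - F v < (⟪gradient F u, u⟫ ^ 2 - ⟪gradient F u, v⟫ ^ 2)
            / (2 * ⟪gradient F u, u⟫)))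

/-- Condition (**): `F` is strictly convex and `⟨f(u),u⟩ > 2F(u)` for all `u ≠ 0`. -/
def CondStarStar (F : EuclideanSpace ℝ (Fin 3) → ℝ) : Prop :=
  StrictConvexOn ℝ Set.univ F ∧
    ∀ u : EuclideanSpace ℝ (Fin 3), u ≠ 0 → 2 * F u < ⟪gradient F u, u⟫

/-- `|f(u)| = o(|u|)` as `u → 0`, for `f = ∇F`. -/
def GradLittleO (F : EuclideanSpace ℝ (Fin 3) → ℝ) : Prop :=
  (fun u => ‖gradient F u‖) =o[nhds (0 : EuclideanSpace ℝ (Fin 3))]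
    fun u : EuclideanSpace ℝ (Fin 3) => ‖u‖

section Calculus

/-- If a superquadratic function has a slope ratio (derivative at t divided by t) that is injective
on the positive half-line, then this ratio is strictly increasing. -/
lemma mul_deriv_lt_mul_deriv_of_superquadratic {g g' : ℝ → ℝ}
    (hg : ∀ t, HasDerivAt g (g' t) t) (hg0 : g 0 = 0)
    (hsuper : ∀ t, 0 < t → 2 * g t < t * g' t)
    (hinj : ∀ s t, 0 < s → s < t → t * g' s ≠ s * g' t) {s t : ℝ} (hs : 0 < s) (hst : s < t) :
    t * g' s < s * g' t := by
  have ht : 0 < t := hs.trans hst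
  have hh : ∀ x, HasDerivAt (fun x => t * g x - g' t * x ^ 2 / 2) (t * g' x - x * g' t) x := by
    intro x
    have h := ((hg x).const_mul t).sub ((((hasDerivAt_id x).pow 2).const_mul (g' t)).div_const 2)
    refine h.congr_deriv ?_
    simp only [id]
    ring
  obtain ⟨c, hc, hc'⟩ := exists_hasDerivAt_eq_slope _ _ ht
    (fun x _ => (hh x).continuousAt.continuousWithinAt) (fun x _ => hh x)
  have hneg : t * g' c - c * g' t < 0 := by
    rw [hc']
    apply div_neg_of_neg_of_pos _ (by linarith)
    rw [hg0]
    nlinarith [mul_lt_mul_of_pos_left (hsuper t ht) ht]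
  have hne : ∀ x ∈ Set.Ioo 0 t, t * g' x - x * g' t ≠ 0 :=
    fun x hx => sub_ne_zero.2 (hinj x t hx.1 hx.2)
  rcases hasDerivWithinAt_forall_lt_or_forall_gt_of_forall_ne (convex_Ioo 0 t)
    (fun x _ => (hh x).hasDerivWithinAt) hne with h | h
  · linarith [h s ⟨hs, hst⟩]
  · linarith [h c hc]

lemma exists_quadratic_lower_bound_of_superquadratic {g g' : ℝ → ℝ}
    (hg : ∀ t, HasDerivAt g (g' t) t) (hg0 : g 0 = 0) (hpos : ∀ t, 0 ≤ t → 0 ≤ g t)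
    (hsuper : ∀ t, 0 < t → 2 * g t < t * g' t)
    (hinj : ∀ s t, 0 < s → s < t → t * g' s ≠ s * g' t) :
    ∃ c K, g' 1 < c ∧ ∀ t, 0 ≤ t → c * t ^ 2 / 2 - K ≤ g t := by
  have hlt {s t : ℝ} (hs : 0 < s) (hst : s < t) :=
    mul_deriv_lt_mul_deriv_of_superquadratic hg hg0 hsuper hinj hs hst
  have h12 := hlt one_pos one_lt_two
  refine ⟨g' 2 / 2, g' 2, by linarith, fun t ht => ?_⟩
  have h2 := hsuper 2 two_pos
  have h2' := hpos 2 two_pos.le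
  rcases le_or_gt t 2 with h | h
  · have : t ^ 2 ≤ 4 := by nlinarith
    nlinarith [hpos t ht]
  · have hh : ∀ x, HasDerivAt (fun x => g x - g' 2 / 2 * x ^ 2 / 2) (g' x - g' 2 / 2 * x) x := by
      intro x
      have h := (hg x).sub ((((hasDerivAt_id x).pow 2).const_mul (g' 2 / 2)).div_const 2)
      refine h.congr_deriv ?_
      simp only [id]
      ring
    obtain ⟨c, hc, hc'⟩ := exists_hasDerivAt_eq_slope _ _ h
      (fun x _ => (hh x).continuousAt.continuousWithinAt) (fun x _ => hh x)
    have h2c := hlt two_pos hc.1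
    rw [eq_div_iff (by linarith)] at hc'
    nlinarith [mul_pos (show 0 < g' c - g' 2 / 2 * c by linarith) (sub_pos.2 h)]

/-- A continuous function on `[0, ∞)` dominated by a concave quadratic attains its maximum. -/
lemma exists_forall_le_of_le_quadratic {φ : ℝ → ℝ} (hφ : Continuous φ) {d b k : ℝ} (hd : 0 < d)
    (hle : ∀ t, 0 ≤ t → φ t ≤ -d * t ^ 2 + b * t + k) :
    ∃ t, 0 ≤ t ∧ ∀ s, 0 ≤ s → φ s ≤ φ t := by
  set T : ℝ := 1 + (|b| + |k - φ 0|) / d with hT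
  have hT1 : 1 ≤ T := by
    have : 0 ≤ (|b| + |k - φ 0|) / d := by positivity
    linarith
  have hdT : d * T = d + (|b| + |k - φ 0|) := by
    rw [hT]
    field_simp
  obtain ⟨t, ht, hmax⟩ := isCompact_Icc.exists_isMaxOn
    (Set.nonempty_Icc.2 (zero_le_one.trans hT1)) hφ.continuousOn
  refine ⟨t, ht.1, fun s hs => ?_⟩
  rcases le_or_gt s T with h | h
  · exact hmax ⟨hs, h⟩
  · have h0 : φ 0 ≤ φ t := hmax ⟨le_rfl, zero_le_one.trans hT1⟩
    have h1 : (d + (|b| + |k - φ 0|)) * s ≤ d * s * s := by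
      rw [← hdT]
      nlinarith [mul_pos hd (show 0 < s by linarith)]
    have h2 : b * s ≤ |b| * s := mul_le_mul_of_nonneg_right (le_abs_self b) hs
    have h3 : k - φ 0 ≤ |k - φ 0| := le_abs_self _
    have h4 : |k - φ 0| ≤ |k - φ 0| * s := le_mul_of_one_le_right (abs_nonneg _) (by linarith)
    nlinarith [hle s hs, mul_nonneg hd.le hs]

end Calculus

section Gradient

variable {E : Type*} [NormedAddCommGroup E] [InnerProductSpace ℝ E] {F : E → ℝ}

/-- Quadratic growth along the ray through `u` passes, up to a factor `l < 1`, to the parallel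
rays. -/
lemma ConvexOn.quadratic_lower_bound_translate (hconv : ConvexOn ℝ Set.univ F) {u : E} {c K : ℝ}
    (hray : ∀ t : ℝ, 0 ≤ t → c * t ^ 2 / 2 - K ≤ F (t • u)) {l : ℝ} (hl0 : 0 < l) (hl1 : l < 1)
    (v : E) : ∃ K', ∀ t : ℝ, 0 ≤ t → l * c * t ^ 2 / 2 - K' ≤ F (t • u + v) := by
  set w : E := (-l / (1 - l)) • v
  refine ⟨(K + (1 - l) * F w) / l, fun t ht => ?_⟩
  have h := hconv.2 (Set.mem_univ (t • u + v)) (Set.mem_univ w) hl0.le (sub_pos.2 hl1).le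
    (add_sub_cancel l 1)
  have hw : l • (t • u + v) + (1 - l) • w = (l * t) • u := by
    have : (1 - l) * (-l / (1 - l)) = -l := mul_div_cancel₀ _ (sub_pos.2 hl1).ne'
    simp only [w, smul_smul, this]
    module
  rw [hw] at h
  have h2 := (hray (l * t) (by positivity)).trans h
  simp only [smul_eq_mul] at h2
  have h3 : l * ((K + (1 - l) * F w) / l) = K + (1 - l) * F w := mul_div_cancel₀ _ hl0.ne'
  refine le_of_mul_le_mul_left ?_ hl0
  rw [mul_sub, h3]
  linarith

variable [CompleteSpace E]

lemma Differentiable.hasDerivAt_smul_add (hF : Differentiable ℝ F) (u v : E) (t : ℝ) :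
    HasDerivAt (fun s : ℝ => F (s • u + v)) ⟪gradient F (t • u + v), u⟫ t := by
  have h := (hF (t • u + v)).hasGradientAt.hasFDerivAt
  have hl : HasDerivAt (fun s : ℝ => s • u + v) u t := by
    simpa using ((hasDerivAt_id t).smul_const u).add_const v
  refine (h.comp_hasDerivAt t hl).congr_deriv ?_
  rw [InnerProductSpace.toDual_apply_apply]

lemma StrictConvexOn.add_inner_gradient_lt (hconv : StrictConvexOn ℝ Set.univ F)
    (hF : Differentiable ℝ F) {x y : E} (hxy : x ≠ y) :
    F x + ⟪gradient F x, y - x⟫ < F y := by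
  have hline : StrictConvexOn ℝ Set.univ (fun s : ℝ => F (s • (y - x) + x)) := by
    refine ⟨convex_univ, fun s _ t _ hst a b ha hb hab => ?_⟩
    have hne : s • (y - x) + x ≠ t • (y - x) + x := by
      intro h
      exact hst (smul_left_injective ℝ (sub_ne_zero.2 hxy.symm) (add_right_cancel h))
    have h := hconv.2 (Set.mem_univ _) (Set.mem_univ _) hne ha hb hab
    convert h using 2
    obtain rfl : b = 1 - a := by linarith
    simp only [smul_eq_mul]
    module
  have h := hline.lt_slope_of_hasDerivAt (Set.mem_univ 0) (Set.mem_univ 1) one_pos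
    (hF.hasDerivAt_smul_add (y - x) x 0)
  simp only [slope_def_field, zero_smul, zero_add, one_smul, sub_add_cancel, sub_zero,
    div_one] at h
  linarith

end Gradient

lemma GradLittleO.gradient_zero {F : EuclideanSpace ℝ (Fin 3) → ℝ} (h : GradLittleO F) :
    gradient F 0 = 0 := by
  have h' := (h.bound one_pos).self_of_nhds
  simpa using h'

lemma CondStar.mul_inner_ne_mul_inner {F : EuclideanSpace ℝ (Fin 3) → ℝ} (hstar : CondStar F)
    {u : EuclideanSpace ℝ (Fin 3)} {s t : ℝ} (hs : 0 < s) (ht : 0 < t)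
    (hpos : 0 < ⟪gradient F (s • u), u⟫) (hne : F (s • u) ≠ F (t • u)) :
    t * ⟪gradient F (s • u), u⟫ ≠ s * ⟪gradient F (t • u), u⟫ := by
  intro heq
  have h1 := (hstar (s • u) (t • u) (by simpa [inner_smul_right] using heq)
    (by simpa [inner_smul_right] using mul_pos ht hpos)).2 hne
  have h2 := (hstar (t • u) (s • u) (by simpa [inner_smul_right] using heq.symm)
    (by simpa [inner_smul_right, heq] using (heq ▸ mul_pos ht hpos :))).2 hne.symm
  simp only [inner_smul_right] at h1 h2
  have hq : ⟪gradient F (t • u), u⟫ = t * (⟪gradient F (s • u), u⟫ / s) := by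
    field_simp
    linarith
  have hp : ⟪gradient F (s • u), u⟫ = s * (⟪gradient F (s • u), u⟫ / s) := by
    field_simp
  have hm : 0 < ⟪gradient F (s • u), u⟫ / s := div_pos hpos hs
  rw [hp] at h1
  rw [hq] at h2
  set m := ⟪gradient F (s • u), u⟫ / s
  have e1 : ((s * (s * m)) ^ 2 - (t * (s * m)) ^ 2) / (2 * (s * (s * m)))
      = m * (s ^ 2 - t ^ 2) / 2 := by
    field_simp
  have e2 : ((t * (t * m)) ^ 2 - (s * (t * m)) ^ 2) / (2 * (t * (t * m)))
      = m * (t ^ 2 - s ^ 2) / 2 := by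
    field_simp
  rw [e1] at h1
  rw [e2] at h2
  linarith

/-- At a critical point of `t ↦ ((t²−1)/2)⟨f(u),u⟩ + t⟨f(u),v⟩ + F(u) − F(tu+v)`, written in terms
of `z = tu + v`, condition (*) gives the inequality of (F9). -/
lemma CondStar.critical_value_nonpos {F : EuclideanSpace ℝ (Fin 3) → ℝ} (hstar : CondStar F)
    (hconv : StrictConvexOn ℝ Set.univ F) (hF : Differentiable ℝ F)
    {u z : EuclideanSpace ℝ (Fin 3)} (hA : 0 < ⟪gradient F u, u⟫)
    (hsuper : 2 * F u < ⟪gradient F u, u⟫) (hz : 0 ≤ F z) {t : ℝ} (ht : 0 ≤ t)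
    (hcrit : t ≠ 0 → ⟪gradient F u, z⟫ = ⟪gradient F z, u⟫) :
    -(t ^ 2 + 1) / 2 * ⟪gradient F u, u⟫ + t * ⟪gradient F u, z⟫ + F u - F z ≤ 0 ∧
    (u ≠ z → -(t ^ 2 + 1) / 2 * ⟪gradient F u, u⟫ + t * ⟪gradient F u, z⟫ + F u - F z < 0) := by
  have hsimple : t * ⟪gradient F u, z⟫ ≤ 0 →
      -(t ^ 2 + 1) / 2 * ⟪gradient F u, u⟫ + t * ⟪gradient F u, z⟫ + F u - F z < 0 := by
    intro h
    nlinarith [mul_nonneg (sq_nonneg t) hA.le]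
  rcases le_or_gt (t * ⟪gradient F u, z⟫) 0 with h | h
  · exact ⟨(hsimple h).le, fun _ => hsimple h⟩
  have ht0 : t ≠ 0 := by
    rintro rfl
    simp at h
  have hB : 0 < ⟪gradient F u, z⟫ := pos_of_mul_pos_right h ht
  have htpos : 0 < t := lt_of_le_of_ne ht ht0.symm
  obtain ⟨hle, hlt⟩ := hstar u z (hcrit ht0) hB
  have hfo (hne : u ≠ z) := hconv.add_inner_gradient_lt hF hne
  simp only [inner_sub_right] at hfo
  set A := ⟪gradient F u, u⟫
  set B := ⟪gradient F u, z⟫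
  have hsq : -(t ^ 2 + 1) / 2 * A + t * B + (A ^ 2 - B ^ 2) / (2 * A)
      = -(t * A - B) ^ 2 / (2 * A) := by
    field_simp
    ring
  have hnp : -(t * A - B) ^ 2 / (2 * A) ≤ 0 :=
    div_nonpos_of_nonpos_of_nonneg (neg_nonpos.2 (sq_nonneg _)) (by linarith)
  refine ⟨by linarith, fun hne => ?_⟩
  by_cases hFe : F u = F z
  · have hBA : B < A := by linarith [hfo hne]
    nlinarith [mul_lt_mul_of_pos_left hBA htpos, mul_nonneg (sq_nonneg (t - 1)) hA.le]
  · linarith [hlt hFe]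

/-- (cf. Remark 5.4 d) and [11, Lemma 5.2]).
If `F : ℝ³ → ℝ` is differentiable, `F(0) = 0`, `|∇F(u)| = o(|u|)` as `u → 0`, and `F`
satisfies (*) and (**), then `F` satisfies (F9). -/
theorem statement13 (F : EuclideanSpace ℝ (Fin 3) → ℝ) (hF : Differentiable ℝ F)
    (hF0 : F 0 = 0) (hsmall : GradLittleO F) (hstar : CondStar F) (hss : CondStarStar F) :
    CondF9 F := by
  obtain ⟨hconv, hsuper⟩ := hss
  have hgrad0 : gradient F 0 = 0 := hsmall.gradient_zero
  have hpos : ∀ x, x ≠ 0 → 0 < F x := by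
    intro x hx
    simpa [hF0, hgrad0] using hconv.add_inner_gradient_lt hF hx.symm
  have hnn : ∀ x, 0 ≤ F x := by
    intro x
    rcases eq_or_ne x 0 with rfl | hx
    · exact hF0.ge
    · exact (hpos x hx).le
  have hApos : ∀ x, x ≠ 0 → 0 < ⟪gradient F x, x⟫ :=
    fun x hx => by linarith [hsuper x hx, hpos x hx]
  intro t ht u v
  rcases eq_or_ne u 0 with rfl | hu
  · have h1 := hnn (t • 0 + v)
    simp only [smul_zero, zero_add] at h1 ⊢
    simp only [hgrad0, inner_zero_left, hF0]
    exact ⟨by linarith, fun h => by linarith [hpos v h.symm]⟩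
  have hder := hF.hasDerivAt_smul_add u v
  have hray (s : ℝ) : HasDerivAt (fun s : ℝ => F (s • u)) ⟪gradient F (s • u), u⟫ s := by
    simpa using hF.hasDerivAt_smul_add u 0 s
  have hraysuper (s : ℝ) (hs : 0 < s) : 2 * F (s • u) < s * ⟪gradient F (s • u), u⟫ := by
    simpa [inner_smul_right] using hsuper (s • u) (smul_ne_zero hs.ne' hu)
  have hraypos (s : ℝ) (hs : 0 < s) : 0 < ⟪gradient F (s • u), u⟫ :=
    pos_of_mul_pos_right (by linarith [hraysuper s hs, hnn (s • u)]) hs.le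
  have hraymono : StrictMonoOn (fun s : ℝ => F (s • u)) (Set.Ici 0) := by
    refine strictMonoOn_of_deriv_pos (convex_Ici 0)
      (fun s _ => (hray s).continuousAt.continuousWithinAt) fun s hs => ?_
    rw [interior_Ici] at hs
    rw [(hray s).deriv]
    exact hraypos s hs
  obtain ⟨c, K, hc, hgrowth⟩ := exists_quadratic_lower_bound_of_superquadratic hray
    (by simpa using hF0) (fun s _ => hnn _) hraysuper
    (fun s r hs hsr => hstar.mul_inner_ne_mul_inner hs (hs.trans hsr) (hraypos s hs)
      (hraymono hs.le (hs.trans hsr).le hsr).ne)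
  rw [one_smul] at hc
  have hA := hApos u hu
  have hc0 : 0 < c := hA.trans hc
  obtain ⟨l, hl, hl1⟩ := exists_between ((div_lt_one hc0).2 hc)
  rw [div_lt_iff₀ hc0] at hl
  have hl0 : 0 < l := pos_of_mul_pos_left (hA.trans hl) hc0.le
  obtain ⟨K', hK'⟩ := hconv.convexOn.quadratic_lower_bound_translate hgrowth hl0 hl1 v
  set φ : ℝ → ℝ := fun s =>
    (s ^ 2 - 1) / 2 * ⟪gradient F u, u⟫ + s * ⟪gradient F u, v⟫ + F u - F (s • u + v) with hφ
  have hφ' (s : ℝ) : HasDerivAt φ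
      (⟪gradient F u, s • u + v⟫ - ⟪gradient F (s • u + v), u⟫) s := by
    have h := ((((((hasDerivAt_id s).pow 2).sub_const 1).div_const 2).mul_const
      ⟪gradient F u, u⟫).add ((hasDerivAt_id s).mul_const ⟪gradient F u, v⟫)).add_const (F u)
    refine (h.sub (hder s)).congr_deriv ?_
    simp only [id, inner_add_right, inner_smul_right]
    ring
  have hform (s : ℝ) : φ s = -(s ^ 2 + 1) / 2 * ⟪gradient F u, u⟫
      + s * ⟪gradient F u, s • u + v⟫ + F u - F (s • u + v) := by
    simp only [hφ, inner_add_right, inner_smul_right]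
    ring
  have hmax (s : ℝ) (hs : 0 ≤ s) (h : ∀ r, 0 ≤ r → φ r ≤ φ s) :
      φ s ≤ 0 ∧ (u ≠ s • u + v → φ s < 0) := by
    rw [hform]
    refine hstar.critical_value_nonpos hconv hF hA (hsuper u hu) (hnn _) hs fun hs0 => ?_
    have hloc : IsLocalMax φ s := by
      filter_upwards [lt_mem_nhds (lt_of_le_of_ne hs hs0.symm)] with r hr using h r hr.le
    exact sub_eq_zero.1 (hloc.hasDerivAt_eq_zero (hφ' s))
  obtain ⟨t₀, ht₀, hmax₀⟩ := exists_forall_le_of_le_quadratic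
    (φ := φ) (d := (l * c - ⟪gradient F u, u⟫) / 2) (b := ⟪gradient F u, v⟫)
    (k := F u + K' - ⟪gradient F u, u⟫ / 2)
    (continuous_iff_continuousAt.2 fun s => (hφ' s).continuousAt) (by linarith)
    (fun s hs => by simp only [hφ]; linarith [hK' s hs])
  have hnonpos (s : ℝ) (hs : 0 ≤ s) : φ s ≤ 0 := (hmax₀ s hs).trans (hmax t₀ ht₀ hmax₀).1
  refine ⟨hnonpos t ht, fun hne => lt_of_le_of_ne (hnonpos t ht) fun h0 => ?_⟩
  exact ((hmax t ht fun r hr => (hnonpos r hr).trans h0.ge).2 hne).ne h0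

end
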